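/- Let N be a natural number, let t : Fin N → Fin 3 record the types of N moves (t i = 0, 1, 2 meaning type RI, RII, RIII respectively), and let c, w : Fin (N+1) → ℤ be sequences of integers such that: whenever t i = 0, |c(i+1) − c(i)| = 1 and |w(i+1) − w(i)| = 1; whenever t i = 1, |c(i+1) − c(i)| = 2 and w(i+1) = w(i); whenever t i = 2, c(i+1) = c(i) and w(i+1) = w(i). Suppose c(0) = 8, w(0) = 4, c(N) = 0, w(N) = 0, and additionally N ≥ 1 and c(1) ≥ c(0) (the first move does not decrease the crossing number). Then N ≥ 7. -/

import Mathlib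

/-- A finite integer sequence dropping by at most `d` at each of its `n` steps drops by at most
`n * d` in total. -/
theorem Fin.sub_mul_le_last {n : ℕ} (f : Fin (n + 1) → ℤ) (d : ℤ)
    (h : ∀ i : Fin n, f i.castSucc - d ≤ f i.succ) : f 0 - n * d ≤ f (Fin.last n) := by
  induction n with
  | zero => simp
  | succ n ih =>
    have hinit := ih (fun i => f i.castSucc) fun i => h i.castSucc
    have hlast := h (Fin.last n)
    simp only [Fin.castSucc_zero, Fin.succ_last] at hinit hlast
    push_cast
    linarith

/-- Full counting argument of the paper's Remark: with 8 crossings and writhe 4 at the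
start, 0 crossings and writhe 0 at the end, and a first move that does not decrease
the crossing number, any such sequence of Reidemeister moves has length at least 7. -/
theorem stmt_5 (N : ℕ) (t : Fin N → Fin 3) (c w : Fin (N + 1) → ℤ)
    (h0 : ∀ i : Fin N, t i = 0 →
      |c i.succ - c i.castSucc| = 1 ∧ |w i.succ - w i.castSucc| = 1)
    (h1 : ∀ i : Fin N, t i = 1 →
      |c i.succ - c i.castSucc| = 2 ∧ w i.succ = w i.castSucc)
    (h2 : ∀ i : Fin N, t i = 2 →
      c i.succ = c i.castSucc ∧ w i.succ = w i.castSucc)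
    (hc0 : c 0 = 8) (hw0 : w 0 = 4)
    (hcN : c (Fin.last N) = 0) (hwN : w (Fin.last N) = 0)
    (hN : 1 ≤ N)
    (hfirst : c 0 ≤ c ⟨1, by omega⟩) :
    7 ≤ N := by
  obtain ⟨M, rfl⟩ : ∃ M, N = M + 1 := ⟨N - 1, by omega⟩
  -- A move lowers `c + w` by at most 2, and not at all if it does not lower `c`.
  have hmove (i : Fin (M + 1)) :
      c i.castSucc + w i.castSucc - 2 ≤ c i.succ + w i.succ ∧
        (c i.castSucc ≤ c i.succ → c i.castSucc + w i.castSucc ≤ c i.succ + w i.succ) := by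
    have ht : t i = 0 ∨ t i = 1 ∨ t i = 2 := by omega
    rcases ht with ht | ht | ht
    · have := h0 i ht
      grind
    · have := h1 i ht
      grind
    · have := h2 i ht
      grind
  have hstart : c 0 + w 0 ≤ c (Fin.succ 0) + w (Fin.succ 0) := (hmove 0).2 hfirst
  have htail : c (Fin.succ 0) + w (Fin.succ 0) - M * 2 ≤
      c (Fin.last (M + 1)) + w (Fin.last (M + 1)) :=
    Fin.sub_mul_le_last (fun i : Fin (M + 1) => c i.succ + w i.succ) 2 fun i => (hmove i.succ).1
  omega
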